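/- arXiv:2403.08446 — 5 statements merged into one kernel-verified Lean document; each statement's English description precedes it below -/
import Mathlib

section
/- Let c = (c₁, c₂, …, c_l) be a nonempty list of integers with every entry ≥ 2, and let n be a nonnegative integer. Set c′ = (c₁ + n, c₂, …, c_l). Then 𝓢(c′) = 𝓢(c) and 𝓡(c′) = qⁿ·𝓡(c) + [n]_q·𝓢(c) in ℤ[q]. (Equivalently, for a rational α > 1 and n ≥ 0, 𝓢_{α+n} = 𝓢_α and 𝓡_{α+n} = qⁿ𝓡_α + [n]_q 𝓢_α, i.e. [α+n]_q = qⁿ[α]_q + [n]_q.) -/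
open Polynomial

/-- The `q`-deformation `[n]_q = 1 + q + ⋯ + q^{n-1}` of a nonnegative integer. -/
noncomputable def qNat (n : ℕ) : Polynomial ℤ := (Finset.range n).sum fun i => X ^ i

/-- The matrix `M_q⁻(c) = (([c]_q, -q^{c-1}), (1, 0))` over `ℤ[q]`. -/
noncomputable def MqNeg (c : ℕ) : Matrix (Fin 2) (Fin 2) (Polynomial ℤ) :=
  !![qNat c, -(X ^ (c - 1)); 1, 0]

/-- `𝓡(c)`: the (0,0) entry of `M_q⁻(c₁)⋯M_q⁻(c_l)`. -/
noncomputable def Rpoly (L : List ℕ) : Polynomial ℤ := ((L.map MqNeg).prod) 0 0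

/-- `𝓢(c)`: the (1,0) entry of `M_q⁻(c₁)⋯M_q⁻(c_l)`. -/
noncomputable def Spoly (L : List ℕ) : Polynomial ℤ := ((L.map MqNeg).prod) 1 0

/-- `r(c) = 𝓡(c)(1)`. -/
noncomputable def rNum (L : List ℕ) : ℤ := (Rpoly L).eval 1

/-- `s(c) = 𝓢(c)(1)`. -/
noncomputable def sNum (L : List ℕ) : ℤ := (Spoly L).eval 1

theorem qNat_add (c n : ℕ) : qNat (c + n) = X ^ n * qNat c + qNat n := by
  simp only [qNat]
  rw [add_comm c n, Finset.sum_range_add, Finset.mul_sum, add_comm]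
  simp only [pow_add]

theorem Spoly_cons (c : ℕ) (T : List ℕ) : Spoly (c :: T) = Rpoly T := by
  simp [Spoly, Rpoly, MqNeg, Matrix.mul_apply, Fin.sum_univ_two]

theorem Rpoly_cons (c : ℕ) (T : List ℕ) :
    Rpoly (c :: T) = qNat c * Rpoly T - X ^ (c - 1) * Spoly T := by
  simp [Spoly, Rpoly, MqNeg, Matrix.mul_apply, Fin.sum_univ_two, sub_eq_add_neg]

/-- For a negative continued-fraction list `c :: T` (entries ≥ 2) and `n ≥ 0`,
adding `n` to the first entry fixes `𝓢` and sends `𝓡` to `qⁿ·𝓡 + [n]_q·𝓢`. -/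
theorem stmt1 (c : ℕ) (hc : 2 ≤ c) (T : List ℕ) (hT : ∀ y ∈ T, 2 ≤ y) (n : ℕ) :
    Spoly ((c + n) :: T) = Spoly (c :: T) ∧
    Rpoly ((c + n) :: T) = X ^ n * Rpoly (c :: T) + qNat n * Spoly (c :: T) := by
  refine ⟨by rw [Spoly_cons, Spoly_cons], ?_⟩
  rw [Rpoly_cons, Rpoly_cons, Spoly_cons, qNat_add, show c + n - 1 = n + (c - 1) by lia, pow_add]
  ring
end

section
/- Let n ≥ 2 and let a₂, …, a_n be positive integers. Let (a, p)ᵀ be the first column of the integer matrix product M(0)·M(a₂)⋯M(a_n) (a product of n matrices), so a/p = [0, a₂, …, a_n] as a regular continued fraction. Then for any integer b with 0 < b < p, the first column of the reversed product M(0)·M(a_n)·M(a_{n−1})⋯M(a₂) equals (b, p)ᵀ if and only if a·b ≡ (−1)ⁿ (mod p). -/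
/-- The continued-fraction matrix `M(a) = ((a, 1), (1, 0))` over `ℤ`. -/
def Mreg (a : ℤ) : Matrix (Fin 2) (Fin 2) ℤ := !![a, 1; 1, 0]

theorem Mreg_mul_apply_zero (a : ℤ) (P : Matrix (Fin 2) (Fin 2) ℤ) (j : Fin 2) :
    (Mreg a * P) 0 j = a * P 0 j + P 1 j := by
  simp [Mreg, Matrix.mul_apply, Fin.sum_univ_two]

theorem Mreg_mul_apply_one (a : ℤ) (P : Matrix (Fin 2) (Fin 2) ℤ) (j : Fin 2) :
    (Mreg a * P) 1 j = P 0 j := by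
  simp [Mreg, Matrix.mul_apply, Fin.sum_univ_two]

theorem Mreg_transpose (a : ℤ) : (Mreg a).transpose = Mreg a := by
  ext i j
  fin_cases i <;> fin_cases j <;> rfl

theorem prod_map_Mreg_reverse (T : List ℤ) :
    (T.reverse.map Mreg).prod = (T.map Mreg).prod.transpose := by
  induction T with
  | nil => simp
  | cons x T ih =>
    rw [List.map_reverse] at ih
    simp [ih, Matrix.transpose_mul, Mreg_transpose]

theorem det_prod_map_Mreg (T : List ℤ) : (T.map Mreg).prod.det = (-1) ^ T.length := by
  induction T with
  | nil => simp
  | cons x T ih =>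
    rw [List.map_cons, List.prod_cons, Matrix.det_mul, ih, List.length_cons, pow_succ']
    simp [Mreg, Matrix.det_fin_two]

/-- In a nonempty product of matrices `M(aᵢ)` with all `aᵢ` positive, both rows are nonnegative
and weakly decreasing. -/
theorem prod_map_Mreg_bounds (T : List ℤ) (hT : T ≠ []) (hpos : ∀ y ∈ T, 0 < y) (i : Fin 2) :
    0 ≤ (T.map Mreg).prod i 1 ∧ (T.map Mreg).prod i 1 ≤ (T.map Mreg).prod i 0 := by
  induction T generalizing i with
  | nil => exact absurd rfl hT
  | cons x T ih =>
    have hx : 0 < x := hpos x List.mem_cons_self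
    rcases eq_or_ne T [] with rfl | hne
    · fin_cases i <;> simp [Mreg]
      omega
    · have ihT := ih hne fun y hy => hpos y (List.mem_cons_of_mem x hy)
      obtain ⟨h0, hle0⟩ := ihT 0
      obtain ⟨h1, hle1⟩ := ihT 1
      rw [List.map_cons, List.prod_cons]
      fin_cases i
      · simp only [Fin.zero_eta, Mreg_mul_apply_zero]
        exact ⟨by positivity, by gcongr⟩
      · simp only [Fin.mk_one, Mreg_mul_apply_one]
        exact ⟨h0, hle0⟩

/-- Let `(a, p)ᵀ` be the first column of `M(0)·M(a₂)⋯M(a_n)` (a product of `n ≥ 2`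
matrices, all entries `aᵢ > 0`), so `a/p = [0, a₂, …, a_n]`.  Then for an integer `b` with
`0 < b < p`, the first column of the reversed product `M(0)·M(a_n)⋯M(a₂)` equals `(b, p)ᵀ`
if and only if `a·b ≡ (−1)ⁿ (mod p)`. -/
theorem stmt4 (T : List ℤ) (hT : T ≠ []) (hTpos : ∀ y ∈ T, 0 < y)
    (a p b : ℤ)
    (ha : ((Mreg 0) * ((T.map Mreg).prod)) 0 0 = a)
    (hp : ((Mreg 0) * ((T.map Mreg).prod)) 1 0 = p)
    (hb : 0 < b) (hbp : b < p) :
    (((Mreg 0) * ((T.reverse.map Mreg).prod)) 0 0 = b ∧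
     ((Mreg 0) * ((T.reverse.map Mreg).prod)) 1 0 = p) ↔
    a * b ≡ (-1) ^ (T.length + 1) [ZMOD p] := by
  rw [prod_map_Mreg_reverse]
  have hdet := det_prod_map_Mreg T
  obtain ⟨hnonneg, hle⟩ := prod_map_Mreg_bounds T hT hTpos 0
  rw [Matrix.det_fin_two] at hdet
  simp only [Mreg_mul_apply_zero, Mreg_mul_apply_one, Matrix.transpose_apply, zero_mul,
    zero_add] at ha hp ⊢
  set P := (T.map Mreg).prod
  rw [ha, hp] at hdet
  rw [hp] at hle
  have hmod : a * P 0 1 ≡ (-1) ^ (T.length + 1) [ZMOD p] :=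
    Int.modEq_iff_dvd.mpr ⟨-P 1 1, by rw [pow_succ, ← hdet]; ring⟩
  constructor
  · rintro ⟨rfl, -⟩
    exact hmod
  · intro h
    refine ⟨?_, hp⟩
    have hcop : IsCoprime p a := by
      refine ⟨P 1 1 * (-1) ^ T.length, -P 0 1 * (-1) ^ T.length, ?_⟩
      calc _ = (p * P 1 1 - P 0 1 * a) * (-1) ^ T.length := by ring
        _ = 1 := by rw [hdet, ← mul_pow]; simp
    have hdvd : p ∣ P 0 1 - b := by
      refine hcop.dvd_of_dvd_mul_left ?_
      rw [mul_sub]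
      exact (h.trans hmod.symm).dvd
    have hzero := Int.eq_zero_of_abs_lt_dvd hdvd (by rw [abs_lt]; constructor <;> omega)
    omega
end

section
/- Let c and c′ be nonempty lists of integers with every entry ≥ 2, and suppose s(c) = s(c′) = p and r(c)·r(c′) ≡ 1 (mod p). Then 𝓢(c′) equals the reciprocal polynomial 𝓢(c)^∨ of 𝓢(c). (In the notation of q-deformed rationals: if a/p and b/p are irreducible fractions with ab ≡ 1 (mod p), then 𝓢_{a/p}(q) = 𝓢_{b/p}^∨(q).) -/
open Polynomial

theorem natDegree_qNat_le (c : ℕ) : (qNat c).natDegree ≤ c - 1 := by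
  refine natDegree_sum_le_of_forall_le _ _ fun i hi => ?_
  rw [natDegree_X_pow]
  have := Finset.mem_range.1 hi
  lia

theorem reflect_qNat (c : ℕ) : reflect (c - 1) (qNat c) = qNat c := by
  have h : ∀ s : Finset ℕ, reflect (c - 1) (s.sum fun i => (X : ℤ[X]) ^ i) =
      s.sum fun i => reflect (c - 1) ((X : ℤ[X]) ^ i) := fun s => by
    induction s using Finset.induction_on with
    | empty => simp
    | insert a s ha ih => rw [Finset.sum_insert ha, Finset.sum_insert ha, reflect_add, ih]
  rw [qNat, h, ← Finset.sum_range_reflect]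
  refine Finset.sum_congr rfl fun i hi => ?_
  have := Finset.mem_range.1 hi
  rw [reflect_monomial, revAt_le (by lia)]
  congr 1
  lia

/-- The product `M_q⁻(c₁)⋯M_q⁻(c_l)`. -/
noncomputable def qProd (T : List ℕ) : Matrix (Fin 2) (Fin 2) ℤ[X] := (T.map MqNeg).prod

/-- The degree `∑ (cᵢ - 1)` of `𝓡(c)`. -/
def qDeg (T : List ℕ) : ℕ := (T.map (· - 1)).sum

theorem qProd_cons (c : ℕ) (T : List ℕ) : qProd (c :: T) = MqNeg c * qProd T := by
  simp [qProd]

theorem qProd_append_singleton (c : ℕ) (T : List ℕ) :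
    qProd (T ++ [c]) = qProd T * MqNeg c := by
  simp [qProd]

theorem natDegree_qProd_le (T : List ℕ) (i j : Fin 2) :
    (qProd T i j).natDegree ≤ qDeg T := by
  induction T generalizing i j with
  | nil => fin_cases i <;> fin_cases j <;> simp [qProd]
  | cons c T ih =>
    have hM : ∀ k, (MqNeg c i k).natDegree ≤ c - 1 := fun k => by
      fin_cases i <;> fin_cases k <;> simp [MqNeg, natDegree_qNat_le]
    rw [qProd_cons, Matrix.mul_apply]
    refine natDegree_sum_le_of_forall_le _ _ fun k _ => ?_
    simpa [qDeg] using natDegree_mul_le.trans (add_le_add (hM k) (ih k j))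

/-- Reversing a list transposes the product, up to signs and `q ↦ q⁻¹`. -/
theorem qProd_reverse (T : List ℕ) :
    qProd T.reverse 0 0 = reflect (qDeg T) (qProd T 0 0) ∧
    qProd T.reverse 0 1 = -reflect (qDeg T) (qProd T 1 0) ∧
    qProd T.reverse 1 0 = -reflect (qDeg T) (qProd T 0 1) ∧
    qProd T.reverse 1 1 = reflect (qDeg T) (qProd T 1 1) := by
  induction T with
  | nil => simp [qProd, qDeg]
  | cons c T ih =>
    have hd : qDeg (c :: T) = (c - 1) + qDeg T := by simp [qDeg]
    have hX : reflect (c - 1) (X ^ (c - 1) : ℤ[X]) = 1 := by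
      rw [reflect_monomial, revAt_le le_rfl]; simp
    obtain ⟨h00, h01, h10, h11⟩ := ih
    have key : ∀ j, reflect (qDeg (c :: T)) (qProd (c :: T) 0 j) =
          qNat c * reflect (qDeg T) (qProd T 0 j) - reflect (qDeg T) (qProd T 1 j) ∧
        reflect (qDeg (c :: T)) (qProd (c :: T) 1 j) =
          X ^ (c - 1) * reflect (qDeg T) (qProd T 0 j) := fun j => by
      have e0 : qProd (c :: T) 0 j = qNat c * qProd T 0 j - X ^ (c - 1) * qProd T 1 j := by
        simp [qProd_cons, Matrix.mul_apply, MqNeg, sub_eq_add_neg]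
      have e1 : qProd (c :: T) 1 j = 1 * qProd T 0 j := by
        simp [qProd_cons, Matrix.mul_apply, MqNeg]
      rw [e0, e1, hd, reflect_sub,
        reflect_mul _ _ (natDegree_qNat_le c) (natDegree_qProd_le T 0 j),
        reflect_mul _ _ (natDegree_X_pow_le _) (natDegree_qProd_le T 1 j),
        reflect_mul _ _ (by simp) (natDegree_qProd_le T 0 j), reflect_qNat, hX, reflect_one, one_mul]
      exact ⟨rfl, rfl⟩
    rw [List.reverse_cons, qProd_append_singleton, (key 0).1, (key 0).2, (key 1).1, (key 1).2]
    simp only [Matrix.mul_apply, Fin.sum_univ_two, h00, h01, h10, h11]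
    refine ⟨?_, ?_, ?_, ?_⟩ <;> simp [MqNeg] <;> ring

theorem coeff_zero_qProd (T : List ℕ) (hT : ∀ y ∈ T, 2 ≤ y) : (qProd T 0 0).coeff 0 = 1 := by
  induction T with
  | nil => simp [qProd]
  | cons c T ih =>
    have hc : 2 ≤ c := hT c (by simp)
    have hq : (qNat c).coeff 0 = 1 := by
      obtain ⟨d, rfl⟩ := Nat.exists_eq_add_of_le' (show 1 ≤ c by lia)
      simp [qNat, Finset.sum_range_succ', coeff_zero_eq_eval_zero, eval_finsetSum]
    have := ih fun y hy => hT y (by simp [hy])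
    simp [qProd_cons, Matrix.mul_apply, MqNeg, mul_coeff_zero, hq, this, coeff_X_pow]
    lia

theorem Rpoly_reverse (T : List ℕ) (hT : ∀ y ∈ T, 2 ≤ y) :
    Rpoly T.reverse = (Rpoly T).reverse := by
  change qProd T.reverse 0 0 = (qProd T 0 0).reverse
  have h := (qProd_reverse T).1
  have hc : (qProd T 0 0).coeff (qDeg T) = 1 := by
    have := coeff_zero_qProd T.reverse (by simpa using hT)
    rwa [h, coeff_reflect, revAt_le (Nat.zero_le _), Nat.sub_zero] at this
  have hd : (qProd T 0 0).natDegree = qDeg T :=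
    le_antisymm (natDegree_qProd_le T 0 0) (le_natDegree_of_ne_zero (by simp [hc]))
  rw [h, Polynomial.reverse, hd]

theorem sNum_cons (c : ℕ) (T : List ℕ) : sNum (c :: T) = rNum T := by
  rw [sNum, Spoly_cons, rNum]

theorem rNum_cons (c : ℕ) (T : List ℕ) : rNum (c :: T) = c * rNum T - sNum T := by
  simp [rNum, sNum, Rpoly, Spoly, Matrix.mul_apply, MqNeg, qNat, eval_finsetSum,
    sub_eq_add_neg]

theorem sNum_nonneg_and_lt_rNum (T : List ℕ) (hT : ∀ y ∈ T, 2 ≤ y) :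
    0 ≤ sNum T ∧ sNum T < rNum T := by
  induction T with
  | nil => simp [sNum, rNum, Spoly, Rpoly]
  | cons c T ih =>
    have hc : (2 : ℤ) ≤ c := by exact_mod_cast hT c (by simp)
    obtain ⟨h0, h1⟩ := ih fun y hy => hT y (by simp [hy])
    rw [sNum_cons, rNum_cons]
    constructor <;> nlinarith

/-- A list with entries at least `2` is determined by the fraction it represents. -/
theorem eq_of_rNum_eq_of_sNum_eq (T U : List ℕ) (hT : ∀ y ∈ T, 2 ≤ y) (hU : ∀ y ∈ U, 2 ≤ y)
    (hr : rNum T = rNum U) (hs : sNum T = sNum U) : T = U := by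
  induction T generalizing U with
  | nil =>
    cases U with
    | nil => rfl
    | cons d U =>
      have := sNum_nonneg_and_lt_rNum U fun y hy => hU y (by simp [hy])
      rw [sNum_cons] at hs
      simp [sNum, Spoly] at hs
      lia
  | cons c T ih =>
    have hT' : ∀ y ∈ T, 2 ≤ y := fun y hy => hT y (by simp [hy])
    obtain ⟨a0, a1⟩ := sNum_nonneg_and_lt_rNum T hT'
    cases U with
    | nil =>
      rw [sNum_cons] at hs
      simp [sNum, Spoly] at hs
      lia
    | cons d U =>
      have hU' : ∀ y ∈ U, 2 ≤ y := fun y hy => hU y (by simp [hy])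
      obtain ⟨b0, b1⟩ := sNum_nonneg_and_lt_rNum U hU'
      rw [sNum_cons, sNum_cons] at hs
      rw [rNum_cons, rNum_cons, ← hs] at hr
      rw [← hs] at b1
      have h1 : (c : ℤ) ≤ d := by by_contra! h; nlinarith
      have h2 : (d : ℤ) ≤ c := by by_contra! h; nlinarith
      obtain rfl : c = d := by lia
      rw [ih U hT' hU' hs (by linarith)]

theorem eval_one_reflect (N : ℕ) (f : ℤ[X]) (hf : f.natDegree ≤ N) :
    (reflect N f).eval 1 = f.eval 1 := by
  let _ : Invertible (1 : ℤ) := invertibleOne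
  simpa only [invOf_one, one_pow, mul_one, eval₂_id] using eval₂_reflect_mul_pow (RingHom.id ℤ) 1 N f hf

theorem rNum_reverse (T : List ℕ) : rNum T.reverse = rNum T := by
  change (qProd T.reverse 0 0).eval 1 = (qProd T 0 0).eval 1
  rw [(qProd_reverse T).1, eval_one_reflect _ _ (natDegree_qProd_le T 0 0)]

theorem sNum_mul_sNum_reverse_modEq (T : List ℕ) :
    sNum T * sNum T.reverse ≡ 1 [ZMOD rNum T] := by
  have hdet : (qProd T 0 0).eval 1 * (qProd T 1 1).eval 1 -
      (qProd T 0 1).eval 1 * (qProd T 1 0).eval 1 = 1 := by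
    rw [← eval_mul, ← eval_mul, ← eval_sub, ← Matrix.det_fin_two]
    induction T with
    | nil => simp [qProd]
    | cons c T ih =>
      rw [qProd_cons, Matrix.det_mul, eval_mul, ih, Matrix.det_fin_two]
      simp [MqNeg]
  have hs : sNum T.reverse = -(qProd T 0 1).eval 1 := by
    change (qProd T.reverse 1 0).eval 1 = _
    rw [(qProd_reverse T).2.2.1, eval_neg, eval_one_reflect _ _ (natDegree_qProd_le T 0 1)]
  rw [hs]
  change (qProd T 1 0).eval 1 * _ ≡ 1 [ZMOD (qProd T 0 0).eval 1]
  exact Int.modEq_iff_dvd.2 ⟨(qProd T 1 1).eval 1, by linear_combination -hdet⟩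

/-- If `a/p` and `b/p` are irreducible fractions (given by negative continued-fraction
lists `L`, `L'`) with `ab ≡ 1 (mod p)`, then `𝓢_{a/p}(q) = 𝓢_{b/p}^∨(q)`. -/
theorem stmt6 (p : ℤ) (L L' : List ℕ)
    (hL : L ≠ []) (hL2 : ∀ y ∈ L, 2 ≤ y)
    (hL' : L' ≠ []) (hL'2 : ∀ y ∈ L', 2 ≤ y)
    (hsL : sNum L = p) (hsL' : sNum L' = p)
    (hmod : rNum L * rNum L' ≡ 1 [ZMOD p]) :
    Spoly L' = (Spoly L).reverse := by
  obtain ⟨c, T, rfl⟩ := List.exists_cons_of_ne_nil hL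
  obtain ⟨d, U, rfl⟩ := List.exists_cons_of_ne_nil hL'
  have hT : ∀ y ∈ T, 2 ≤ y := fun y hy => hL2 y (by simp [hy])
  have hU : ∀ y ∈ U, 2 ≤ y := fun y hy => hL'2 y (by simp [hy])
  have hTr : ∀ y ∈ T.reverse, 2 ≤ y := by simpa using hT
  rw [sNum_cons] at hsL hsL'
  rw [rNum_cons, rNum_cons, hsL, hsL'] at hmod
  have h1 : sNum T * sNum U ≡ 1 [ZMOD p] := by
    refine Int.ModEq.trans (Int.modEq_iff_dvd.2 ⟨c * d * p - c * sNum U - d * sNum T, ?_⟩) hmod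
    ring
  have h2 : sNum T * sNum T.reverse ≡ 1 [ZMOD p] := hsL ▸ sNum_mul_sNum_reverse_modEq T
  have h3 : sNum U ≡ sNum T.reverse [ZMOD p] := by
    have e1 : sNum U * (sNum T * sNum T.reverse) ≡ sNum U * 1 [ZMOD p] := h2.mul_left _
    have e2 : sNum T.reverse * (sNum T * sNum U) ≡ sNum T.reverse * 1 [ZMOD p] := h1.mul_left _
    rw [mul_one] at e1 e2
    rw [show sNum U * (sNum T * sNum T.reverse) = sNum T.reverse * (sNum T * sNum U) by ring] at e1
    exact e1.symm.trans e2
  obtain ⟨u0, u1⟩ := sNum_nonneg_and_lt_rNum U hU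
  obtain ⟨t0, t1⟩ := sNum_nonneg_and_lt_rNum T.reverse hTr
  rw [hsL'] at u1
  rw [rNum_reverse, hsL] at t1
  have hs : sNum U = sNum T.reverse := by
    rwa [Int.ModEq, Int.emod_eq_of_lt u0 u1, Int.emod_eq_of_lt t0 t1] at h3
  have hUT := eq_of_rNum_eq_of_sNum_eq U T.reverse hU hTr
    (by rw [rNum_reverse, hsL, hsL']) hs
  rw [Spoly_cons, Spoly_cons, hUT, Rpoly_reverse T hT]
end

section
/- Let c and c′ be nonempty lists of integers with every entry ≥ 2, and suppose s(c) = s(c′) = p and r(c)·r(c′) ≡ −1 (mod p). Then 𝓢(c) = 𝓢(c′) in ℤ[q]. (In the notation of q-deformed rationals: for any positive integer p and irreducible fractions a/p, b/p with ab ≡ −1 (mod p), one has 𝓢_{a/p}(q) = 𝓢_{b/p}(q); this is the sufficiency part of the arithmetic conjecture, valid without assuming p prime.) -/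
open Polynomial

/-- The two letters: `A = ((q, 1), (0, 1))`, which increments the first entry of a list, and
`M_q⁻(2) = ((1 + q, -q), (1, 0))`, which prepends the entry `2`. -/
noncomputable def letterMat : Bool → Matrix (Fin 2) (Fin 2) (Polynomial ℤ)
  | true => !![X, 1; 0, 1]
  | false => !![1 + X, -X; 1, 0]

/-- The symmetric matrix intertwining each letter with the transpose of the other one. -/
noncomputable def intertwiner : Matrix (Fin 2) (Fin 2) (Polynomial ℤ) := !![1 + X, 1; 1, 1]

/-- The product of the letters of a word, multiplied on the right by the intertwiner. -/
noncomputable def wordMat (w : List Bool) : Matrix (Fin 2) (Fin 2) (Polynomial ℤ) :=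
  (w.map letterMat).prod * intertwiner

theorem wordMat_nil : wordMat [] = intertwiner := by simp [wordMat]

theorem wordMat_cons (b : Bool) (w : List Bool) :
    wordMat (b :: w) = letterMat b * wordMat w := by
  simp [wordMat, Matrix.mul_assoc]

theorem intertwiner_mul_transpose (b : Bool) :
    intertwiner * (letterMat b).transpose = letterMat (!b) * intertwiner := by
  cases b <;> ext1 i j <;> fin_cases i <;> fin_cases j <;>
    simp [intertwiner, letterMat, Matrix.mul_apply, Fin.sum_univ_two] <;> ring

theorem intertwiner_mul_transpose_prod (w : List Bool) :
    intertwiner * ((w.map letterMat).prod).transpose = wordMat (w.map not).reverse := by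
  induction w with
  | nil => simp [wordMat]
  | cons b w ih =>
    rw [wordMat] at ih ⊢
    rw [List.map_cons, List.prod_cons, Matrix.transpose_mul, ← Matrix.mul_assoc, ih,
      Matrix.mul_assoc, intertwiner_mul_transpose]
    simp [Matrix.mul_assoc]

/-- Transposing corresponds to swapping the letters and reversing the word. -/
theorem wordMat_transpose (w : List Bool) :
    (wordMat w).transpose = wordMat (w.map not).reverse := by
  have h : intertwiner.transpose = intertwiner := by
    ext1 i j
    fin_cases i <;> fin_cases j <;> simp [intertwiner]
  rw [← intertwiner_mul_transpose_prod, wordMat, Matrix.transpose_mul, h]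

theorem eval_det_wordMat (w : List Bool) : (wordMat w).det.eval 1 = 1 := by
  induction w with
  | nil => simp [wordMat_nil, intertwiner, Matrix.det_fin_two]
  | cons b w ih =>
    rw [wordMat_cons, Matrix.det_mul, eval_mul, ih]
    cases b <;> simp [letterMat, Matrix.det_fin_two]

theorem wordMat_true_zero (w : List Bool) :
    wordMat (true :: w) 0 0 = X * wordMat w 0 0 + wordMat w 1 0 := by
  simp [wordMat_cons, letterMat, Matrix.mul_apply, Fin.sum_univ_two]

theorem wordMat_true_one (w : List Bool) : wordMat (true :: w) 1 0 = wordMat w 1 0 := by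
  simp [wordMat_cons, letterMat, Matrix.mul_apply, Fin.sum_univ_two]

theorem wordMat_false_zero (w : List Bool) :
    wordMat (false :: w) 0 0 = (1 + X) * wordMat w 0 0 - X * wordMat w 1 0 := by
  simp [wordMat_cons, letterMat, Matrix.mul_apply, Fin.sum_univ_two, sub_eq_add_neg]

theorem wordMat_false_one (w : List Bool) : wordMat (false :: w) 1 0 = wordMat w 0 0 := by
  simp [wordMat_cons, letterMat, Matrix.mul_apply, Fin.sum_univ_two]

theorem eval_wordMat_bounds (w : List Bool) :
    0 < (wordMat w 1 0).eval 1 ∧ (wordMat w 1 0).eval 1 < (wordMat w 0 0).eval 1 := by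
  induction w with
  | nil => simp [wordMat_nil, intertwiner]
  | cons b w ih =>
    cases b <;>
      simp only [wordMat_true_zero, wordMat_true_one, wordMat_false_zero, wordMat_false_one,
        eval_add, eval_sub, eval_mul, eval_X, eval_one] <;> constructor <;> linarith

/-- A word is determined by the value at `q = 1` of the first column of its matrix. -/
theorem word_eq_of_eval_eq (w w' : List Bool)
    (h0 : (wordMat w 0 0).eval 1 = (wordMat w' 0 0).eval 1)
    (h1 : (wordMat w 1 0).eval 1 = (wordMat w' 1 0).eval 1) : w = w' := by
  induction w generalizing w' with
  | nil =>
    cases w' with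
    | nil => rfl
    | cons b w' =>
      have := eval_wordMat_bounds w'
      cases b <;>
        simp [wordMat_true_zero, wordMat_true_one, wordMat_false_zero, wordMat_false_one,
          wordMat_nil, intertwiner] at h0 h1 <;> omega
  | cons b w ih =>
    have hw := eval_wordMat_bounds w
    cases w' with
    | nil =>
      cases b <;>
        simp [wordMat_true_zero, wordMat_true_one, wordMat_false_zero, wordMat_false_one,
          wordMat_nil, intertwiner] at h0 h1 <;> omega
    | cons b' w' =>
      have hw' := eval_wordMat_bounds w'
      cases b <;> cases b' <;>
        simp only [wordMat_true_zero, wordMat_true_one, wordMat_false_zero, wordMat_false_one,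
          eval_add, eval_sub, eval_mul, eval_X, eval_one] at h0 h1
      · rw [ih w' (by linarith) (by linarith)]
      · omega
      · omega
      · rw [ih w' (by linarith) (by linarith)]

theorem Rpoly_nil : Rpoly [] = 1 := by simp [Rpoly]

theorem Spoly_nil : Spoly [] = 0 := by simp [Spoly]

theorem Rpoly_succ_cons (c : ℕ) (hc : 1 ≤ c) (T : List ℕ) :
    Rpoly ((c + 1) :: T) = X * Rpoly (c :: T) + Spoly (c :: T) := by
  obtain ⟨k, rfl⟩ := Nat.exists_eq_add_of_le' hc
  have h : qNat (k + 1 + 1) = X * qNat (k + 1) + 1 := by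
    rw [qNat, qNat, Finset.sum_range_succ', Finset.mul_sum]
    simp [pow_succ']
  rw [Rpoly_cons, Rpoly_cons, Spoly_cons, h]
  simp only [Nat.add_sub_cancel]
  ring

/-- Every nonempty list with entries at least `2` is encoded by a word. -/
theorem exists_word (T : List ℕ) (hT : T ≠ []) (hT2 : ∀ y ∈ T, 2 ≤ y) :
    ∃ w, Rpoly T = wordMat w 0 0 ∧ Spoly T = wordMat w 1 0 := by
  induction T with
  | nil => exact absurd rfl hT
  | cons c T ih =>
    have hc : 2 ≤ c := hT2 c (by simp)
    clear hT
    replace ih := fun h => ih h fun y hy => hT2 y (by simp [hy])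
    clear hT2
    induction c, hc using Nat.le_induction with
    | base =>
      have h2 : qNat 2 = 1 + X := by simp [qNat, Finset.sum_range_succ]
      rcases eq_or_ne T [] with rfl | hT
      · exact ⟨[], by simp [Rpoly_cons, Rpoly_nil, Spoly_nil, h2, wordMat_nil, intertwiner],
          by simp [Spoly_cons, Rpoly_nil, wordMat_nil, intertwiner]⟩
      · obtain ⟨w, hR, hS⟩ := ih hT
        exact ⟨false :: w, by simp [Rpoly_cons, h2, wordMat_false_zero, hR, hS],
          by rw [Spoly_cons, wordMat_false_one, hR]⟩
    | succ c hc ihc =>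
      obtain ⟨w, hR, hS⟩ := ihc
      exact ⟨true :: w, by rw [Rpoly_succ_cons c (by omega), wordMat_true_zero, hR, hS],
        by rw [wordMat_true_one, ← hS, Spoly_cons, Spoly_cons]⟩

/-- Words whose numerators at `q = 1` agree and whose denominators multiply to `-1` modulo the
numerator have the same numerator polynomial. -/
theorem wordMat_eq_of_modEq (w w' : List Bool)
    (h0 : (wordMat w 0 0).eval 1 = (wordMat w' 0 0).eval 1)
    (hmod : (wordMat w 1 0).eval 1 * (wordMat w' 1 0).eval 1 ≡ -1
      [ZMOD (wordMat w 0 0).eval 1]) :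
    wordMat w 0 0 = wordMat w' 0 0 := by
  have ht := wordMat_transpose w
  have h00 : wordMat w 0 0 = wordMat (w.map not).reverse 0 0 := by
    rw [← ht, Matrix.transpose_apply]
  have h10 : wordMat w 0 1 = wordMat (w.map not).reverse 1 0 := by
    rw [← ht, Matrix.transpose_apply]
  have hd := eval_det_wordMat w
  have hb := eval_wordMat_bounds (w.map not).reverse
  have hb' := eval_wordMat_bounds w'
  rw [Matrix.det_fin_two] at hd
  simp only [eval_sub, eval_mul] at hd
  rw [← h00, ← h10] at hb
  rw [← h0] at hb'
  suffices h : (w.map not).reverse = w' by rw [h00, h]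
  refine word_eq_of_eval_eq _ _ (by rw [← h00, h0]) ?_
  rw [← h10]
  generalize (wordMat w 0 0).eval 1 = p at *
  generalize (wordMat w 1 0).eval 1 = s at *
  generalize (wordMat w 0 1).eval 1 = t at *
  generalize (wordMat w 1 1).eval 1 = d at *
  generalize (wordMat w' 1 0).eval 1 = s' at *
  have key : t ≡ s' [ZMOD p] := by
    rw [Int.modEq_iff_dvd] at hmod ⊢
    obtain ⟨k, hk⟩ := hmod
    exact ⟨t * k + s' * d, by linear_combination t * hk - s' * hd⟩
  rw [Int.ModEq, Int.emod_eq_of_lt hb.1.le hb.2, Int.emod_eq_of_lt hb'.1.le hb'.2] at key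
  exact key

/-- Sufficiency part of the arithmetic conjecture: if `a/p` and `b/p` are irreducible
fractions (given by negative continued-fraction lists `L`, `L'`) with `ab ≡ −1 (mod p)`,
then `𝓢_{a/p}(q) = 𝓢_{b/p}(q)`. -/
theorem stmt7 (p : ℤ) (L L' : List ℕ)
    (hL : L ≠ []) (hL2 : ∀ y ∈ L, 2 ≤ y)
    (hL' : L' ≠ []) (hL'2 : ∀ y ∈ L', 2 ≤ y)
    (hsL : sNum L = p) (hsL' : sNum L' = p)
    (hmod : rNum L * rNum L' ≡ -1 [ZMOD p]) :
    Spoly L = Spoly L' := by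
  obtain ⟨c, T, rfl⟩ := List.exists_cons_of_ne_nil hL
  obtain ⟨c', T', rfl⟩ := List.exists_cons_of_ne_nil hL'
  have hex : ∀ U : List ℕ, U ≠ [] → (∀ y ∈ U, 2 ≤ y) → 1 < (Rpoly U).eval 1 := by
    intro U hU hU2
    obtain ⟨w, hR, -⟩ := exists_word U hU hU2
    have := eval_wordMat_bounds w
    rw [hR]
    omega
  have hT2 : ∀ y ∈ T, 2 ≤ y := fun y hy => hL2 y (by simp [hy])
  have hT'2 : ∀ y ∈ T', 2 ≤ y := fun y hy => hL'2 y (by simp [hy])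
  simp only [sNum, Spoly_cons] at hsL hsL' ⊢
  rcases eq_or_ne T [] with rfl | hT
  · rcases eq_or_ne T' [] with rfl | hT'
    · rfl
    · have := hex T' hT' hT'2
      simp [Rpoly_nil] at hsL
      omega
  rcases eq_or_ne T' [] with rfl | hT'
  · have := hex T hT hT2
    simp [Rpoly_nil] at hsL'
    omega
  have hr : ∀ (n : ℕ) (U : List ℕ), (Rpoly U).eval 1 = p →
      rNum (n :: U) ≡ -(Spoly U).eval 1 [ZMOD p] := by
    intro n U hU
    rw [Int.modEq_iff_dvd, rNum, Rpoly_cons]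
    simp only [eval_sub, eval_mul, eval_pow, eval_X, one_pow, hU]
    exact ⟨-(qNat n).eval 1, by ring⟩
  have hm := ((hr c T hsL).mul (hr c' T' hsL')).symm.trans hmod
  rw [neg_mul_neg] at hm
  obtain ⟨w, hR, hS⟩ := exists_word T hT hT2
  obtain ⟨w', hR', hS'⟩ := exists_word T' hT' hT'2
  rw [hR, hR']
  rw [hR] at hsL
  rw [hR'] at hsL'
  exact wordMat_eq_of_modEq w w' (hsL.trans hsL'.symm) (by rwa [hsL, ← hS, ← hS'])
end

section
/- Let c be a nonempty list of integers with every entry ≥ 2. Then the polynomial 𝓢(c) ∈ ℤ[q] is palindromic (i.e. 𝓢(c)^∨ = 𝓢(c)) if and only if r(c)² ≡ 1 (mod s(c)). (In the notation of q-deformed rationals: for an irreducible fraction r/s, 𝓢_{r/s}(q) is palindromic if and only if r² ≡ 1 (mod s).) -/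
open Polynomial

namespace QRational

/-- The specialization at `q = 1` of the matrix product attached to `L`. -/
noncomputable def contMat (L : List ℕ) : Matrix (Fin 2) (Fin 2) ℤ :=
  (L.map fun c : ℕ => !![(c : ℤ), -1; 1, 0]).prod

/-- The degree `∑ (cᵢ - 1)` of `𝓡(c)`. -/
def excess (L : List ℕ) : ℕ := (L.map fun c => c - 1).sum

lemma Rpoly_nil : Rpoly [] = 1 := by simp [Rpoly]

lemma Spoly_cons (a : ℕ) (L : List ℕ) : Spoly (a :: L) = Rpoly L := by
  simp [Spoly, Rpoly, MqNeg, Matrix.mul_apply, Fin.sum_univ_two]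

lemma Rpoly_cons (a : ℕ) (L : List ℕ) :
    Rpoly (a :: L) = qNat a * Rpoly L - X ^ (a - 1) * Spoly L := by
  simp [Spoly, Rpoly, MqNeg, Matrix.mul_apply, Fin.sum_univ_two]
  ring

lemma Rpoly_singleton (a : ℕ) : Rpoly [a] = qNat a := by
  simp [Rpoly, MqNeg]

lemma Rpoly_cons_cons (a b : ℕ) (L : List ℕ) :
    Rpoly (a :: b :: L) = qNat a * Rpoly (b :: L) - X ^ (a - 1) * Rpoly L := by
  rw [Rpoly_cons, Spoly_cons]

lemma Rpoly_append_pair (L : List ℕ) (b a : ℕ) :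
    Rpoly (L ++ [b, a]) = qNat a * Rpoly (L ++ [b]) - X ^ (b - 1) * Rpoly L := by
  simp [Rpoly, MqNeg, Matrix.mul_apply, Fin.sum_univ_two]
  ring

lemma qNat_succ (n : ℕ) : qNat (n + 1) = qNat n + X ^ n := by
  simp [qNat, Finset.sum_range_succ]

lemma qNat_eval_one (n : ℕ) : (qNat n).eval 1 = n := by
  simp [qNat, eval_finsetSum]

lemma two_mul_derivative_qNat_eval_one (n : ℕ) :
    2 * (derivative (qNat n)).eval 1 = (n : ℤ) * (n - 1) := by
  induction n with
  | zero => simp [qNat]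
  | succ n ih =>
    rw [qNat_succ]
    simp only [derivative_add, derivative_X_pow, eval_add, mul_add, ih]
    simp
    ring

lemma natDegree_qNat_le (n : ℕ) : (qNat n).natDegree ≤ n - 1 := by
  refine natDegree_sum_le_of_forall_le _ _ fun i hi => ?_
  rw [natDegree_X_pow]
  have := Finset.mem_range.mp hi
  omega

lemma coeff_qNat (n i : ℕ) : (qNat n).coeff i = if i < n then 1 else 0 := by
  simp [qNat, coeff_X_pow]

lemma reflect_qNat (n : ℕ) : reflect (n - 1) (qNat n) = qNat n := by
  ext i
  rw [coeff_reflect, coeff_qNat, coeff_qNat]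
  by_cases h : i ≤ n - 1
  · rw [revAt_le h]
    grind
  · rw [revAt_eq_self_of_lt (by omega)]

lemma Rpoly_natDegree_le (L : List ℕ) (h : ∀ y ∈ L, 2 ≤ y) :
    (Rpoly L).natDegree ≤ excess L ∧ (Rpoly L).coeff (excess L) = 1 := by
  induction L using List.twoStepInduction with
  | nil => simp [Rpoly_nil, excess]
  | singleton a =>
    have := h a (by simp)
    rw [Rpoly_singleton]
    refine ⟨by simpa [excess] using natDegree_qNat_le a, ?_⟩
    rw [coeff_qNat, if_pos]
    simp [excess]
    omega
  | cons_cons a b L ih1 ih2 =>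
    have ha := h a (by simp)
    have hb := h b (by simp)
    obtain ⟨d1, -⟩ := ih1 fun y hy => h y (by simp [hy])
    obtain ⟨d2, c2⟩ := ih2 b fun y hy => h y (by simp at hy ⊢; tauto)
    have e1 : excess (a :: b :: L) = (a - 1) + excess (b :: L) := by simp [excess]
    have e2 : excess (b :: L) = (b - 1) + excess L := by simp [excess]
    have hlow : (X ^ (a - 1) * Rpoly L).natDegree < excess (a :: b :: L) := by
      refine lt_of_le_of_lt (natDegree_mul_le.trans
        (add_le_add (natDegree_X_pow_le _) d1)) ?_
      omega
    have hq := natDegree_qNat_le a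
    rw [Rpoly_cons_cons]
    refine ⟨(natDegree_sub_le _ _).trans (max_le ?_ hlow.le), ?_⟩
    · rw [e1]
      exact natDegree_mul_le.trans (add_le_add hq d2)
    · rw [coeff_sub, coeff_eq_zero_of_natDegree_lt hlow, e1,
        coeff_mul_add_eq_of_natDegree_le hq d2, c2, coeff_qNat, if_pos (by omega)]
      simp

lemma Rpoly_natDegree (L : List ℕ) (h : ∀ y ∈ L, 2 ≤ y) :
    (Rpoly L).natDegree = excess L := by
  obtain ⟨h1, h2⟩ := Rpoly_natDegree_le L h
  exact natDegree_eq_of_le_of_coeff_ne_zero h1 (by simp [h2])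

lemma reflect_Rpoly (L : List ℕ) (h : ∀ y ∈ L, 2 ≤ y) :
    reflect (excess L) (Rpoly L) = Rpoly L.reverse := by
  induction L using List.twoStepInduction with
  | nil => simp [Rpoly_nil, excess, reflect_one]
  | singleton a => simpa [Rpoly_singleton, excess] using reflect_qNat a
  | cons_cons a b L ih1 ih2 =>
    have h1 : ∀ y ∈ L, 2 ≤ y := fun y hy => h y (by simp [hy])
    have h2 : ∀ y ∈ b :: L, 2 ≤ y := fun y hy => h y (by simp at hy ⊢; tauto)
    have e1 : excess (a :: b :: L) = (a - 1) + excess (b :: L) := by simp [excess]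
    have e2 : excess (a :: b :: L) = ((a - 1) + (b - 1)) + excess L := by
      simp [excess, add_assoc]
    have hX : reflect ((a - 1) + (b - 1)) (X ^ (a - 1) : ℤ[X]) = X ^ (b - 1) := by
      rw [reflect_monomial, revAt_le (by omega)]
      congr 1
      omega
    have hr : (a :: b :: L).reverse = L.reverse ++ [b, a] := by simp
    rw [Rpoly_cons_cons, reflect_sub, hr, Rpoly_append_pair, ← ih1 h1,
      ← List.reverse_cons, ← ih2 b h2]
    congr 1
    · rw [e1, reflect_mul _ _ (natDegree_qNat_le a) (Rpoly_natDegree_le _ h2).1, reflect_qNat]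
    · rw [e2, reflect_mul _ _ ((natDegree_X_pow_le _).trans (by omega))
        (Rpoly_natDegree_le _ h1).1, hX]

lemma reverse_Rpoly (L : List ℕ) (h : ∀ y ∈ L, 2 ≤ y) :
    (Rpoly L).reverse = Rpoly L.reverse := by
  rw [reverse, Rpoly_natDegree L h, reflect_Rpoly L h]

lemma contMat_cons (a : ℕ) (L : List ℕ) :
    contMat (a :: L) = !![(a : ℤ), -1; 1, 0] * contMat L := by
  simp [contMat]

lemma contMat_cons_entries (a : ℕ) (L : List ℕ) :
    contMat (a :: L) 0 0 = a * contMat L 0 0 - contMat L 1 0 ∧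
    contMat (a :: L) 0 1 = a * contMat L 0 1 - contMat L 1 1 ∧
    contMat (a :: L) 1 0 = contMat L 0 0 ∧ contMat (a :: L) 1 1 = contMat L 0 1 := by
  simp [contMat_cons, Matrix.mul_apply, Fin.sum_univ_two, sub_eq_add_neg]

lemma det_contMat (L : List ℕ) : (contMat L).det = 1 := by
  induction L with
  | nil => simp [contMat]
  | cons a L ih => rw [contMat_cons, Matrix.det_mul, ih, Matrix.det_fin_two_of]; simp

lemma contMat_det_entries (L : List ℕ) :
    contMat L 0 0 * contMat L 1 1 - contMat L 0 1 * contMat L 1 0 = 1 := by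
  rw [← Matrix.det_fin_two, det_contMat]

lemma contMat_reverse (L : List ℕ) :
    contMat L.reverse =
      !![contMat L 0 0, -contMat L 1 0; -contMat L 0 1, contMat L 1 1] := by
  induction L with
  | nil => ext i j; fin_cases i <;> fin_cases j <;> simp [contMat]
  | cons a L ih =>
    obtain ⟨h1, h2, h3, h4⟩ := contMat_cons_entries a L
    have : contMat (a :: L).reverse = contMat L.reverse * !![(a : ℤ), -1; 1, 0] := by
      simp [contMat]
    rw [this, ih, h1, h2, h3, h4]
    ext i j
    fin_cases i <;> fin_cases j <;> simp [Matrix.mul_apply, Fin.sum_univ_two] <;> ring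

lemma eval_one_Rpoly_Spoly (L : List ℕ) :
    (Rpoly L).eval 1 = contMat L 0 0 ∧ (Spoly L).eval 1 = contMat L 1 0 := by
  induction L with
  | nil => simp [Rpoly, Spoly, contMat]
  | cons a L ih =>
    obtain ⟨h1, h2, h3, h4⟩ := contMat_cons_entries a L
    rw [Rpoly_cons, Spoly_cons, h1, h3]
    simp [ih, qNat_eval_one]

/-- The first derivative at `q = 1` of the first column of the matrix product is determined by
the degree and the specialization at `q = 1`. -/
lemma two_mul_derivative_eval_one (L : List ℕ) (h : ∀ y ∈ L, 2 ≤ y) :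
    2 * (derivative (Rpoly L)).eval 1 =
      excess L * contMat L 0 0 + (contMat L 1 0 + contMat L 0 1) ∧
    2 * (derivative (Spoly L)).eval 1 =
      excess L * contMat L 1 0 + (contMat L 1 1 + contMat L 1 0 - contMat L 0 0) := by
  induction L with
  | nil => simp [Rpoly, Spoly, contMat, excess]
  | cons a L ih =>
    have ha := h a (by simp)
    obtain ⟨i1, i2⟩ := ih fun y hy => h y (by simp [hy])
    obtain ⟨h1, h2, h3, h4⟩ := contMat_cons_entries a L
    obtain ⟨v1, v2⟩ := eval_one_Rpoly_Spoly L
    have hq := two_mul_derivative_qNat_eval_one a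
    have e : (excess (a :: L) : ℤ) = (a - 1) + excess L := by
      simp [excess, Nat.cast_sub (by omega : 1 ≤ a)]
    rw [Rpoly_cons, Spoly_cons, h1, h2, h3, h4, e]
    constructor
    · simp only [derivative_sub, derivative_mul, derivative_X_pow, eval_sub, eval_add, eval_mul,
        eval_pow, eval_X, one_pow, v1, v2, qNat_eval_one]
      simp [Nat.cast_sub (by omega : 1 ≤ a)]
      linear_combination contMat L 0 0 * hq + a * i1 - i2
    · rw [i1]
      ring

lemma contMat_bounds (L : List ℕ) (h : ∀ y ∈ L, 2 ≤ y) :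
    0 ≤ contMat L 1 0 ∧ contMat L 1 0 < contMat L 0 0 := by
  induction L with
  | nil => simp [contMat]
  | cons a L ih =>
    have ha : (2 : ℤ) ≤ a := by exact_mod_cast h a (by simp)
    obtain ⟨i1, i2⟩ := ih fun y hy => h y (by simp [hy])
    obtain ⟨h1, -, h3, -⟩ := contMat_cons_entries a L
    rw [h1, h3]
    constructor <;> nlinarith

/-- Uniqueness of the negative continued fraction expansion. -/
lemma contMat_col_injective (L L' : List ℕ) (h : ∀ y ∈ L, 2 ≤ y) (h' : ∀ y ∈ L', 2 ≤ y)
    (h0 : contMat L 0 0 = contMat L' 0 0) (h1 : contMat L 1 0 = contMat L' 1 0) : L = L' := by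
  induction L generalizing L' with
  | nil =>
    cases L' with
    | nil => rfl
    | cons b L' =>
      have := contMat_bounds L' fun y hy => h' y (by simp [hy])
      rw [(contMat_cons_entries b L').2.2.1] at h1
      simp [contMat] at h1 this
      omega
  | cons a L ih =>
    have hL := contMat_bounds L fun y hy => h y (by simp [hy])
    obtain ⟨a1, -, a3, -⟩ := contMat_cons_entries a L
    cases L' with
    | nil =>
      rw [a3] at h1
      simp [contMat] at h1 hL
      omega
    | cons b L' =>
      have hL' := contMat_bounds L' fun y hy => h' y (by simp [hy])
      obtain ⟨b1, -, b3, -⟩ := contMat_cons_entries b L'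
      rw [a3, b3] at h1
      rw [a1, b1, ← h1] at h0
      rw [← h1] at hL'
      have hab : (a : ℤ) = b := by
        have k1 : (a : ℤ) - b < 1 := by
          by_contra! hc
          nlinarith
        have k2 : (b : ℤ) - a < 1 := by
          by_contra! hc
          nlinarith
        omega
      rw [hab] at h0
      rw [ih L' (fun y hy => h y (by simp [hy])) (fun y hy => h' y (by simp [hy])) h1
        (by linarith), Nat.cast_injective hab]

lemma reverse_Rpoly_eq_self_iff (L : List ℕ) (h : ∀ y ∈ L, 2 ≤ y) :
    (Rpoly L).reverse = Rpoly L ↔ contMat L 0 0 ∣ contMat L 1 0 ^ 2 - 1 := by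
  have hr : ∀ y ∈ L.reverse, 2 ≤ y := fun y hy => h y (by simpa using hy)
  have r00 : contMat L.reverse 0 0 = contMat L 0 0 := by simp [contMat_reverse]
  have r01 : contMat L.reverse 0 1 = -contMat L 1 0 := by simp [contMat_reverse]
  have r10 : contMat L.reverse 1 0 = -contMat L 0 1 := by simp [contMat_reverse]
  have hdet := contMat_det_entries L
  rw [reverse_Rpoly L h]
  constructor
  · intro heq
    have d1 := (two_mul_derivative_eval_one L h).1
    have d2 := (two_mul_derivative_eval_one L.reverse hr).1
    have he : excess L.reverse = excess L := by simp [excess, List.sum_reverse]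
    rw [heq, r00, r01, r10, he] at d2
    have hs : contMat L 0 1 = -contMat L 1 0 := by linarith
    rw [hs] at hdet
    exact ⟨-contMat L 1 1, by linear_combination hdet⟩
  · rintro ⟨k, hk⟩
    have b1 := contMat_bounds L h
    have b2 := contMat_bounds L.reverse hr
    rw [r00, r10] at b2
    have hdvd : contMat L 0 0 ∣ contMat L 1 0 + contMat L 0 1 :=
      ⟨contMat L 1 0 * contMat L 1 1 - contMat L 0 1 * k, by
        linear_combination (-contMat L 1 0) * hdet - contMat L 0 1 * hk⟩
    have hs : contMat L 1 0 + contMat L 0 1 = 0 :=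
      Int.eq_zero_of_abs_lt_dvd hdvd (abs_lt.mpr ⟨by linarith, by linarith⟩)
    rw [contMat_col_injective L.reverse L hr h r00 (by linarith)]

end QRational

/-- For an irreducible fraction `r/s` (given by a negative continued-fraction list `L`),
`𝓢_{r/s}(q)` is palindromic if and only if `r² ≡ 1 (mod s)`. -/
theorem stmt8 (L : List ℕ) (hL : L ≠ []) (hL2 : ∀ y ∈ L, 2 ≤ y) :
    (Spoly L).reverse = Spoly L ↔ rNum L ^ 2 ≡ 1 [ZMOD sNum L] := by
  obtain _ | ⟨a, L⟩ := L
  · exact absurd rfl hL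
  · rw [QRational.Spoly_cons, QRational.reverse_Rpoly_eq_self_iff L fun y hy => hL2 y (by simp [hy])]
    have hr : rNum (a :: L) = a * QRational.contMat L 0 0 - QRational.contMat L 1 0 :=
      (QRational.eval_one_Rpoly_Spoly _).1.trans (QRational.contMat_cons_entries a L).1
    have hs : sNum (a :: L) = QRational.contMat L 0 0 :=
      (QRational.eval_one_Rpoly_Spoly _).2.trans (QRational.contMat_cons_entries a L).2.2.1
    rw [hr, hs, Int.modEq_comm, Int.modEq_iff_dvd]
    exact dvd_iff_dvd_of_dvd_sub ⟨a * (2 * QRational.contMat L 1 0 -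
      a * QRational.contMat L 0 0), by ring⟩
end
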